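/- arXiv:1709.08542 — 2 statements merged into one kernel-verified Lean document; each statement's English description precedes it below -/
import Mathlib

section
/- Let Ψ be a C^∞ positive function on ℝ^d with 1 ≤ C Ψ(x) and |B_{jk}(x)| ≤ C Ψ(x), |∂_{x_ℓ} B_{jk}(x)| ≤ C Ψ(x) for all x and some C > 0, together with |∂^α Ψ(x)| ≤ C_α Ψ(x) for |α| ≤ 1. Then for each pair j < k there is a constant C' > 0 such that for all complex-valued u ∈ C_0^∞(ℝ^d), ‖ Ψ^{−1/2} B_{jk} u ‖² ≤ C' ( Σ_{m=1}^d ‖X_m u‖² + ‖u‖² ), and consequently ‖ Ψ^{−1/2} B_{jk} u ‖² ≤ C' ( ‖P_{A,W} u‖ ‖u‖ + ‖u‖² ). -/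
open MeasureTheory Real Filter

noncomputable section

/-- `ℝ^d` with the Euclidean structure. -/
abbrev Rd (d : ℕ) := EuclideanSpace ℝ (Fin d)

/-- Partial derivative `∂_{x_j}` of a complex-valued function. -/
def pdC {d : ℕ} (j : Fin d) (f : Rd d → ℂ) : Rd d → ℂ :=
  fun x => fderiv ℝ f x (EuclideanSpace.single j (1:ℝ))

/-- Partial derivative `∂_{x_j}` of a real-valued function. -/
def pdR {d : ℕ} (j : Fin d) (f : Rd d → ℝ) : Rd d → ℝ :=
  fun x => fderiv ℝ f x (EuclideanSpace.single j (1:ℝ))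

/-- Iterated partial derivative in the `j`-th direction. -/
def pdIter {d : ℕ} (j : Fin d) : ℕ → (Rd d → ℝ) → (Rd d → ℝ)
  | 0, f => f
  | n+1, f => pdR j (pdIter j n f)

/-- Multi-index partial derivative `∂^α`. -/
def pdMulti {d : ℕ} (α : Fin d → ℕ) (f : Rd d → ℝ) : Rd d → ℝ :=
  (List.finRange d).foldr (fun j g => pdIter j (α j) g) f

/-- The finite set of multi-indices `α` with `|α| = q`. -/
def mIdx (d q : ℕ) : Finset (Fin d → ℕ) := Finset.Nat.antidiagonalTuple d q

/-- The magnetic field `B_{jk} = ∂_j A_k - ∂_k A_j`. -/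
def magB {d : ℕ} (A : Fin d → Rd d → ℝ) (j k : Fin d) : Rd d → ℝ :=
  fun x => pdR j (A k) x - pdR k (A j) x

/-- The quantity `m̌_q(x)`. -/
def mq {d p : ℕ} (A : Fin d → Rd d → ℝ) (U : Fin p → Rd d → ℝ) (V : Rd d → ℝ) :
    ℕ → Rd d → ℝ
  | 0, x => ∑ ℓ, |U ℓ x|
  | q+1, x =>
      (∑ ℓ, ∑ α ∈ mIdx d (q+1), |pdMulti α (U ℓ) x|)
      + (∑ jk ∈ Finset.univ.filter (fun jk : Fin d × Fin d => jk.1 < jk.2),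
          ∑ α ∈ mIdx d q, |pdMulti α (magB A jk.1 jk.2) x|)
      + ∑ α ∈ mIdx d q, |pdMulti α V x|

/-- The quantity `m̌ʳ(x) = 1 + ∑_{q=0}^r m̌_q(x)`. -/
def mr {d p : ℕ} (A : Fin d → Rd d → ℝ) (U : Fin p → Rd d → ℝ) (V : Rd d → ℝ)
    (r : ℕ) (x : Rd d) : ℝ :=
  1 + ∑ q ∈ Finset.range (r+1), mq A U V q x

/-- The magnetic derivative `X_j u = (D_{x_j} - A_j) u`, `D_{x_j} = -i ∂_{x_j}`. -/
def Xop {d : ℕ} (A : Fin d → Rd d → ℝ) (j : Fin d) (u : Rd d → ℂ) : Rd d → ℂ :=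
  fun x => -Complex.I * pdC j u x - (A j x : ℂ) * u x

/-- The potential `W = ∑_ℓ U_ℓ² + iV`. -/
def Wfun {d p : ℕ} (U : Fin p → Rd d → ℝ) (V : Rd d → ℝ) (x : Rd d) : ℂ :=
  ((∑ ℓ, (U ℓ x)^2 : ℝ) : ℂ) + (V x : ℝ) * Complex.I

/-- The operator `P_{A,W} u = ∑_j X_j² u + W u` with `W = ∑_ℓ U_ℓ² + iV`. -/
def Pop {d p : ℕ} (A : Fin d → Rd d → ℝ) (U : Fin p → Rd d → ℝ) (V : Rd d → ℝ)
    (u : Rd d → ℂ) : Rd d → ℂ :=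
  fun x => (∑ j, Xop A j (Xop A j u) x) + Wfun U V x * u x

/-- The function `Φ(x,t)`. -/
def Phi {d p : ℕ} (A : Fin d → Rd d → ℝ) (U : Fin p → Rd d → ℝ) (V : Rd d → ℝ)
    (r : ℕ) (x : Rd d) (t : ℝ) : ℝ :=
  (∑ ℓ, ∑ q ∈ Finset.range (r+1), t^(q+1) * ∑ α ∈ mIdx d q, |pdMulti α (U ℓ) x|)
  + (∑ jk ∈ Finset.univ.filter (fun jk : Fin d × Fin d => jk.1 < jk.2),
      ∑ q ∈ Finset.range r, t^(q+2) * ∑ α ∈ mIdx d q, |pdMulti α (magB A jk.1 jk.2) x|)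
  + ∑ q ∈ Finset.range r, t^(q+2) * ∑ α ∈ mIdx d q, |pdMulti α V x|

/-- `R(x,μ) = sup { t ∈ [0,1] : Φ(x,t) ≤ μ }`. -/
def Rfun {d p : ℕ} (A : Fin d → Rd d → ℝ) (U : Fin p → Rd d → ℝ) (V : Rd d → ℝ)
    (r : ℕ) (x : Rd d) (μ : ℝ) : ℝ :=
  sSup {t : ℝ | t ∈ Set.Icc (0:ℝ) 1 ∧ Phi A U V r x t ≤ μ}



section helpers

theorem sm_pdR {d : ℕ} {f : Rd d → ℝ} (m : Fin d) (hf : ContDiff ℝ (⊤ : ℕ∞) f) :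
    ContDiff ℝ (⊤ : ℕ∞) (pdR m f) := by
  have h : ContDiff ℝ (⊤ : ℕ∞) (fderiv ℝ f) := hf.fderiv_right (by norm_cast)
  exact h.clm_apply contDiff_const

theorem sm_diff {d : ℕ} {f : Rd d → ℝ} (hf : ContDiff ℝ (⊤ : ℕ∞) f) (x : Rd d) :
    DifferentiableAt ℝ f x := (hf.differentiable (by simp)) x

theorem pdR_mul' {d : ℕ} {f g : Rd d → ℝ} (m : Fin d) (hf : ContDiff ℝ (⊤ : ℕ∞) f)
    (hg : ContDiff ℝ (⊤ : ℕ∞) g) (x : Rd d) :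
    pdR m (fun y => f y * g y) x = pdR m f x * g x + f x * pdR m g x := by
  unfold pdR
  rw [fderiv_fun_mul (sm_diff hf x) (sm_diff hg x)]
  simp; ring

theorem pdR_add' {d : ℕ} {f g : Rd d → ℝ} (m : Fin d) (hf : ContDiff ℝ (⊤ : ℕ∞) f)
    (hg : ContDiff ℝ (⊤ : ℕ∞) g) (x : Rd d) :
    pdR m (fun y => f y + g y) x = pdR m f x + pdR m g x := by
  unfold pdR
  rw [fderiv_fun_add (sm_diff hf x) (sm_diff hg x)]
  simp

theorem pdR_sub' {d : ℕ} {f g : Rd d → ℝ} (m : Fin d) (hf : ContDiff ℝ (⊤ : ℕ∞) f)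
    (hg : ContDiff ℝ (⊤ : ℕ∞) g) (x : Rd d) :
    pdR m (fun y => f y - g y) x = pdR m f x - pdR m g x := by
  unfold pdR
  rw [fderiv_fun_sub (sm_diff hf x) (sm_diff hg x)]
  simp

theorem pdR_neg' {d : ℕ} {f : Rd d → ℝ} (m : Fin d) (x : Rd d) :
    pdR m (fun y => - f y) x = - pdR m f x := by
  unfold pdR
  rw [fderiv_fun_neg]
  simp

theorem pdR_comm' {d : ℕ} {f : Rd d → ℝ} (j k : Fin d) (hf : ContDiff ℝ (⊤ : ℕ∞) f)
    (x : Rd d) : pdR j (pdR k f) x = pdR k (pdR j f) x := by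
  have h : ContDiff ℝ (⊤ : ℕ∞) (fderiv ℝ f) := hf.fderiv_right (by norm_cast)
  have hd : DifferentiableAt ℝ (fderiv ℝ f) x := (h.differentiable (by simp)) x
  have key : ∀ j k : Fin d, pdR j (pdR k f) x =
      fderiv ℝ (fderiv ℝ f) x (EuclideanSpace.single j (1:ℝ))
        (EuclideanSpace.single k (1:ℝ)) := by
    intro j k
    unfold pdR
    rw [fderiv_clm_apply hd (differentiableAt_const _)]
    simp
  rw [key, key]
  have hs : IsSymmSndFDerivAt ℝ f x :=
    hf.contDiffAt.isSymmSndFDerivAt (by simp; norm_cast)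
  exact hs _ _

theorem pdR_zero_off {d : ℕ} {f : Rd d → ℝ} {K : Set (Rd d)} (hK : IsClosed K) (m : Fin d)
    (hf : ∀ x, x ∉ K → f x = 0) : ∀ x, x ∉ K → pdR m f x = 0 := by
  intro x hx
  have h : f =ᶠ[nhds x] fun _ => 0 := by
    filter_upwards [hK.isOpen_compl.mem_nhds hx] with y hy using hf y hy
  unfold pdR
  rw [h.fderiv_eq]
  simp

theorem integrable_off {d : ℕ} {f : Rd d → ℝ} {K : Set (Rd d)} (hK : IsCompact K)
    (hc : Continuous f) (hf : ∀ x, x ∉ K → f x = 0) : Integrable f :=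
  hc.integrable_of_hasCompactSupport (HasCompactSupport.intro hK hf)

theorem integral_pdR {d : ℕ} {f : Rd d → ℝ} {K : Set (Rd d)} (hK : IsCompact K) (m : Fin d)
    (hs : ContDiff ℝ (⊤ : ℕ∞) f) (hf : ∀ x, x ∉ K → f x = 0) :
    ∫ x, pdR m f x = 0 := by
  have h1 := integrable_off hK hs.continuous hf
  have h2 := integrable_off hK (sm_pdR m hs).continuous (pdR_zero_off hK.isClosed m hf)
  have := integral_mul_fderiv_eq_neg_fderiv_mul_of_integrable (μ := (volume : Measure (Rd d)))
    (f := fun _ : Rd d => (1:ℝ)) (g := f)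
    (v := EuclideanSpace.single m (1:ℝ)) (by simp) (by simp only [one_mul]; exact h2) (by simpa using h1)
    (fun x _ => differentiableAt_const _) (fun x _ => sm_diff hs x)
  simpa [pdR] using this

/-- Real part of `X_m (a + i b)`. -/
def pX {d : ℕ} (A : Fin d → Rd d → ℝ) (m : Fin d) (a b : Rd d → ℝ) : Rd d → ℝ :=
  fun x => pdR m b x - A m x * a x

/-- Imaginary part of `X_m (a + i b)`. -/
def qX {d : ℕ} (A : Fin d → Rd d → ℝ) (m : Fin d) (a b : Rd d → ℝ) : Rd d → ℝ :=
  fun x => - pdR m a x - A m x * b x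

/-- Complex function with given real and imaginary part. -/
def cx {d : ℕ} (a b : Rd d → ℝ) : Rd d → ℂ := fun x => (a x : ℂ) + (b x : ℂ) * Complex.I

theorem sm_pX {d : ℕ} {A : Fin d → Rd d → ℝ} {m : Fin d} {a b : Rd d → ℝ}
    (hA : ContDiff ℝ (⊤ : ℕ∞) (A m))
    (ha : ContDiff ℝ (⊤ : ℕ∞) a) (hb : ContDiff ℝ (⊤ : ℕ∞) b) :
    ContDiff ℝ (⊤ : ℕ∞) (pX A m a b) := (sm_pdR m hb).sub (hA.mul ha)

theorem sm_qX {d : ℕ} {A : Fin d → Rd d → ℝ} {m : Fin d} {a b : Rd d → ℝ}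
    (hA : ContDiff ℝ (⊤ : ℕ∞) (A m))
    (ha : ContDiff ℝ (⊤ : ℕ∞) a) (hb : ContDiff ℝ (⊤ : ℕ∞) b) :
    ContDiff ℝ (⊤ : ℕ∞) (qX A m a b) := (sm_pdR m ha).neg.sub (hA.mul hb)

theorem Xop_cx {d : ℕ} {A : Fin d → Rd d → ℝ} {m : Fin d} {a b : Rd d → ℝ}
    (ha : ContDiff ℝ (⊤ : ℕ∞) a) (hb : ContDiff ℝ (⊤ : ℕ∞) b) :
    Xop A m (cx a b) = cx (pX A m a b) (qX A m a b) := by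
  funext x
  have h1 : HasFDerivAt (fun y => (a y : ℂ)) (Complex.ofRealCLM.comp (fderiv ℝ a x)) x :=
    Complex.ofRealCLM.hasFDerivAt.comp x (sm_diff ha x).hasFDerivAt
  have h2 : HasFDerivAt (fun y => (b y : ℂ)) (Complex.ofRealCLM.comp (fderiv ℝ b x)) x :=
    Complex.ofRealCLM.hasFDerivAt.comp x (sm_diff hb x).hasFDerivAt
  have h3 := h1.add (h2.mul_const Complex.I)
  have h4 : pdC m (cx a b) x = (pdR m a x : ℂ) + (pdR m b x : ℂ) * Complex.I := by
    unfold pdC pdR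
    have : fderiv ℝ (cx a b) x = _ := h3.fderiv
    rw [this]
    simp [mul_comm]
  unfold Xop
  rw [h4]
  apply Complex.ext <;> simp [cx, pX, qX]

theorem norm_cx {d : ℕ} (a b : Rd d → ℝ) (x : Rd d) : ‖cx a b x‖^2 = a x ^ 2 + b x ^ 2 := by
  rw [← Complex.normSq_eq_norm_sq, Complex.normSq_apply]
  simp [cx]; ring

theorem first_bound (d : ℕ)
    (A : Fin d → Rd d → ℝ)
    (hA : ∀ m, ContDiff ℝ (⊤ : ℕ∞) (A m))
    (j k : Fin d) (g : Rd d → ℝ) (hg : ContDiff ℝ (⊤ : ℕ∞) g) (M : ℝ)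
    (hM : ∀ x, |g x| ≤ M) (hM' : ∀ ℓ x, |pdR ℓ g x| ≤ M)
    (K : Set (Rd d)) (hK : IsCompact K) (a b : Rd d → ℝ)
    (ha : ContDiff ℝ (⊤ : ℕ∞) a) (hb : ContDiff ℝ (⊤ : ℕ∞) b)
    (haK : ∀ x, x ∉ K → a x = 0) (hbK : ∀ x, x ∉ K → b x = 0) :
    (∫ x, g x * magB A j k x * (a x ^ 2 + b x ^ 2)) ≤
      (2 * M) * ((∑ m, ∫ x, (pX A m a b x ^ 2 + qX A m a b x ^ 2)) + ∫ x, (a x ^ 2 + b x ^ 2)) := by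
  have M0 : 0 ≤ M := (abs_nonneg _).trans (hM 0)
  have sp := fun m => sm_pX (hA m) ha hb
  have sq := fun m => sm_qX (hA m) ha hb
  have pK : ∀ m x, x ∉ K → pX A m a b x = 0 := fun m x hx => by
    simp [pX, haK x hx, pdR_zero_off hK.isClosed m hbK x hx]
  have qK : ∀ m x, x ∉ K → qX A m a b x = 0 := fun m x hx => by
    simp [qX, hbK x hx, pdR_zero_off hK.isClosed m haK x hx]
  let F : Fin d → Rd d → ℝ := fun m x => a x * pX A m a b x + b x * qX A m a b x
  have sF : ∀ m, ContDiff ℝ (⊤ : ℕ∞) (F m) := fun m => (ha.mul (sp m)).add (hb.mul (sq m))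
  have FK : ∀ m x, x ∉ K → F m x = 0 := fun m x hx => by simp [F, haK x hx, hbK x hx]
  have dF : ∀ i m x, pdR i (F m) x =
      pdR i a x * pX A m a b x + a x * (pdR i (pdR m b) x - (pdR i (A m) x * a x + A m x * pdR i a x))
      + (pdR i b x * qX A m a b x
        + b x * (- pdR i (pdR m a) x - (pdR i (A m) x * b x + A m x * pdR i b x))) := by
    intro i m x
    have e1 : pdR i (pX A m a b) x =
        pdR i (pdR m b) x - (pdR i (A m) x * a x + A m x * pdR i a x) := by
      unfold pX
      rw [pdR_sub' i (sm_pdR m hb) ((hA m).mul ha), pdR_mul' i (hA m) ha]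
    have e2 : pdR i (qX A m a b) x =
        - pdR i (pdR m a) x - (pdR i (A m) x * b x + A m x * pdR i b x) := by
      unfold qX
      rw [pdR_sub' i (sm_pdR m ha).neg ((hA m).mul hb), pdR_mul' i (hA m) hb, pdR_neg']
    simp only [F]
    rw [pdR_add' i (ha.mul (sp m)) (hb.mul (sq m)), pdR_mul' i ha (sp m), pdR_mul' i hb (sq m),
      e1, e2]
  have curl : ∀ x, pdR j (F k) x - pdR k (F j) x =
      2 * (pX A j a b x * qX A k a b x - qX A j a b x * pX A k a b x)
        - magB A j k x * (a x ^ 2 + b x ^ 2) := by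
    intro x
    rw [dF, dF, pdR_comm' j k ha, pdR_comm' j k hb]
    simp only [pX, qX, magB]
    ring
  have sB : ContDiff ℝ (⊤ : ℕ∞) (magB A j k) := (sm_pdR j (hA k)).sub (sm_pdR k (hA j))
  have sG : ∀ m, ContDiff ℝ (⊤ : ℕ∞) (fun x => g x * F m x) := fun m => hg.mul (sF m)
  have GK : ∀ m x, x ∉ K → g x * F m x = 0 := fun m x hx => by simp [FK m x hx]
  have I1 := integral_pdR hK j (sG k) (GK k)
  have I2 := integral_pdR hK k (sG j) (GK j)
  have L1 := integrable_off hK (sm_pdR j (sG k)).continuous (pdR_zero_off hK.isClosed j (GK k))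
  have L2 := integrable_off hK (sm_pdR k (sG j)).continuous (pdR_zero_off hK.isClosed k (GK j))
  have L3 : Integrable (fun x => g x * magB A j k x * (a x ^ 2 + b x ^ 2)) :=
    integrable_off hK ((hg.mul sB).mul ((ha.pow 2).add (hb.pow 2))).continuous
      (fun x hx => by simp [haK x hx, hbK x hx])
  have L4 : ∀ m, Integrable (fun x => pX A m a b x ^ 2 + qX A m a b x ^ 2) := fun m =>
    integrable_off hK (((sp m).pow 2).add ((sq m).pow 2)).continuous
      (fun x hx => by simp [pK m x hx, qK m x hx])
  have L5 : Integrable (fun x => a x ^ 2 + b x ^ 2) :=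
    integrable_off hK ((ha.pow 2).add (hb.pow 2)).continuous
      (fun x hx => by simp [haK x hx, hbK x hx])
  have L6 : Integrable (fun x => ∑ m, (pX A m a b x ^ 2 + qX A m a b x ^ 2)) :=
    integrable_finsetSum _ (fun m _ => L4 m)
  rw [← integral_finsetSum _ (fun m _ => L4 m), ← integral_add L6 L5, ← integral_const_mul]
  have e : (∫ x, g x * magB A j k x * (a x ^ 2 + b x ^ 2)) =
      ∫ x, (g x * magB A j k x * (a x ^ 2 + b x ^ 2)
        + pdR j (fun x => g x * F k x) x - pdR k (fun x => g x * F j x) x) := by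
    have L31 : Integrable (fun x => g x * magB A j k x * (a x ^ 2 + b x ^ 2)
        + pdR j (fun x => g x * F k x) x) := L3.add L1
    rw [integral_sub L31 L2, integral_add L3 L1, I1, I2]; ring
  rw [e]
  refine integral_mono ((L3.add L1).sub L2) ((L6.add L5).const_mul _) ?_
  intro x
  show g x * magB A j k x * (a x ^ 2 + b x ^ 2)
        + pdR j (fun x => g x * F k x) x - pdR k (fun x => g x * F j x) x ≤
      2 * M * ((∑ m, (pX A m a b x ^ 2 + qX A m a b x ^ 2)) + (a x ^ 2 + b x ^ 2))
  rw [pdR_mul' j hg (sF k), pdR_mul' k hg (sF j)]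
  have hj : pX A j a b x ^ 2 + qX A j a b x ^ 2 ≤ ∑ m, (pX A m a b x ^ 2 + qX A m a b x ^ 2) :=
    Finset.single_le_sum (f := fun m => pX A m a b x ^ 2 + qX A m a b x ^ 2)
      (fun m _ => by positivity) (Finset.mem_univ j)
  have hk : pX A k a b x ^ 2 + qX A k a b x ^ 2 ≤ ∑ m, (pX A m a b x ^ 2 + qX A m a b x ^ 2) :=
    Finset.single_le_sum (f := fun m => pX A m a b x ^ 2 + qX A m a b x ^ 2)
      (fun m _ => by positivity) (Finset.mem_univ k)
  set S := ∑ m, (pX A m a b x ^ 2 + qX A m a b x ^ 2) with hS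
  have ee : g x * magB A j k x * (a x ^ 2 + b x ^ 2)
      + (pdR j g x * F k x + g x * pdR j (F k) x) - (pdR k g x * F j x + g x * pdR k (F j) x)
      = g x * (2 * (pX A j a b x * qX A k a b x - qX A j a b x * pX A k a b x))
        + pdR j g x * F k x - pdR k g x * F j x := by
    linear_combination (g x) * curl x
  rw [ee]
  have bd : ∀ s t T : ℝ, |s| ≤ M → |t| ≤ T → s * t ≤ M * T := fun s t T h1 h2 =>
    (le_abs_self _).trans (by rw [abs_mul]; exact mul_le_mul h1 h2 (abs_nonneg _) M0)
  have b1 := bd (g x) (2 * (pX A j a b x * qX A k a b x - qX A j a b x * pX A k a b x))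
    ((pX A j a b x ^ 2 + qX A j a b x ^ 2) + (pX A k a b x ^ 2 + qX A k a b x ^ 2)) (hM x) (by
      rw [abs_le]; constructor <;>
      nlinarith [sq_nonneg (pX A j a b x - qX A k a b x), sq_nonneg (pX A j a b x + qX A k a b x),
        sq_nonneg (qX A j a b x - pX A k a b x), sq_nonneg (qX A j a b x + pX A k a b x)])
  have bF : ∀ m, |F m x| ≤ ((pX A m a b x ^ 2 + qX A m a b x ^ 2) + (a x ^ 2 + b x ^ 2)) / 2 := by
    intro m
    simp only [F]
    rw [abs_le]; constructor <;>
    nlinarith [sq_nonneg (pX A m a b x - a x), sq_nonneg (pX A m a b x + a x),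
        sq_nonneg (qX A m a b x - b x), sq_nonneg (qX A m a b x + b x)]
  have b2 := bd _ _ _ (hM' j x) (bF k)
  have b3 := bd (-pdR k g x) _ _ (by rw [abs_neg]; exact hM' k x) (bF j)
  -- When `j = k` the naive sum would need a factor 3; use curl vanishing only through bounds
  by_cases hjk : j = k
  · subst hjk
    have : g x * (2 * (pX A j a b x * qX A j a b x - qX A j a b x * pX A j a b x)) = 0 := by ring
    rw [this]
    nlinarith [mul_le_mul_of_nonneg_left hj M0, mul_nonneg M0 (by positivity : 0 ≤ a x ^ 2 + b x ^ 2)]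
  · have hjk2 : (pX A j a b x ^ 2 + qX A j a b x ^ 2) + (pX A k a b x ^ 2 + qX A k a b x ^ 2) ≤ S := by
      rw [hS, ← Finset.sum_pair (f := fun m => pX A m a b x ^ 2 + qX A m a b x ^ 2) hjk]
      exact Finset.sum_le_sum_of_subset_of_nonneg (Finset.subset_univ _)
        (fun m _ _ => by positivity)
    nlinarith [mul_le_mul_of_nonneg_left hjk2 M0,
      mul_nonneg M0 (by positivity : 0 ≤ a x ^ 2 + b x ^ 2),
      mul_nonneg M0 ((by positivity : 0 ≤ pX A j a b x ^ 2 + qX A j a b x ^ 2).trans hj)]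

theorem second_bound (d p : ℕ)
    (A : Fin d → Rd d → ℝ) (U : Fin p → Rd d → ℝ) (V : Rd d → ℝ)
    (hA : ∀ m, ContDiff ℝ (⊤ : ℕ∞) (A m)) (hU : ∀ ℓ, ContDiff ℝ (⊤ : ℕ∞) (U ℓ))
    (hV : ContDiff ℝ (⊤ : ℕ∞) V)
    (K : Set (Rd d)) (hK : IsCompact K) (a b : Rd d → ℝ)
    (ha : ContDiff ℝ (⊤ : ℕ∞) a) (hb : ContDiff ℝ (⊤ : ℕ∞) b)
    (haK : ∀ x, x ∉ K → a x = 0) (hbK : ∀ x, x ∉ K → b x = 0) :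
    (∑ m, ∫ x, (pX A m a b x ^ 2 + qX A m a b x ^ 2)) ≤
      Real.sqrt (∫ x : Rd d, ‖Pop A U V (cx a b) x‖^2)
              * Real.sqrt (∫ x : Rd d, ‖cx a b x‖^2) := by
  have sp := fun m => sm_pX (hA m) ha hb
  have sq := fun m => sm_qX (hA m) ha hb
  have pK : ∀ m x, x ∉ K → pX A m a b x = 0 := fun m x hx => by
    simp [pX, haK x hx, pdR_zero_off hK.isClosed m hbK x hx]
  have qK : ∀ m x, x ∉ K → qX A m a b x = 0 := fun m x hx => by
    simp [qX, hbK x hx, pdR_zero_off hK.isClosed m haK x hx]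
  have hP : ∀ x, Pop A U V (cx a b) x =
      (∑ m, cx (pX A m (pX A m a b) (qX A m a b)) (qX A m (pX A m a b) (qX A m a b)) x)
        + Wfun U V x * cx a b x := by
    intro x
    unfold Pop
    congr 1
    refine Finset.sum_congr rfl (fun m _ => ?_)
    rw [Xop_cx ha hb, Xop_cx (sp m) (sq m)]
  have ccx : ∀ {f g : Rd d → ℝ}, ContDiff ℝ (⊤ : ℕ∞) f → ContDiff ℝ (⊤ : ℕ∞) g →
      Continuous (cx f g) := by
    intro f g hf hg
    have := hf.continuous
    have := hg.continuous
    unfold cx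
    fun_prop
  have cW : Continuous (Wfun U V) := by
    have := fun ℓ => (hU ℓ).continuous
    have := hV.continuous
    unfold Wfun
    fun_prop
  have cP : Continuous (Pop A U V (cx a b)) := by
    rw [funext hP]
    exact (continuous_finsetSum _ (fun m _ => ccx (sm_pX (hA m) (sp m) (sq m))
      (sm_qX (hA m) (sp m) (sq m)))).add (cW.mul (ccx ha hb))
  have cu := ccx ha hb
  have uK : ∀ x, x ∉ K → cx a b x = 0 := fun x hx => by simp [cx, haK x hx, hbK x hx]
  have PK : ∀ x, x ∉ K → Pop A U V (cx a b) x = 0 := fun x hx => by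
    rw [hP, uK x hx]
    have : ∀ m, cx (pX A m (pX A m a b) (qX A m a b)) (qX A m (pX A m a b) (qX A m a b)) x = 0 := by
      intro m
      have e1 : pX A m (pX A m a b) (qX A m a b) x =
        pdR m (qX A m a b) x - A m x * pX A m a b x := rfl
      have e2 : qX A m (pX A m a b) (qX A m a b) x =
        - pdR m (pX A m a b) x - A m x * qX A m a b x := rfl
      simp [cx, e1, e2, pK m x hx, qK m x hx,
        pdR_zero_off hK.isClosed m (pK m) x hx, pdR_zero_off hK.isClosed m (qK m) x hx]
    simp [this]
  have L4 : ∀ m, Integrable (fun x => pX A m a b x ^ 2 + qX A m a b x ^ 2) := fun m =>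
    integrable_off hK (((sp m).pow 2).add ((sq m).pow 2)).continuous
      (fun x hx => by simp [pK m x hx, qK m x hx])
  let h : Fin d → Rd d → ℝ := fun m x => a x * qX A m a b x - b x * pX A m a b x
  have sh : ∀ m, ContDiff ℝ (⊤ : ℕ∞) (h m) := fun m => (ha.mul (sq m)).sub (hb.mul (sp m))
  have hhK : ∀ m x, x ∉ K → h m x = 0 := fun m x hx => by simp [h, haK x hx, hbK x hx]
  have Ih := fun m => integral_pdR hK m (sh m) (hhK m)
  have Lh := fun m => integrable_off hK (sm_pdR m (sh m)).continuous
    (pdR_zero_off hK.isClosed m (hhK m))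
  have dh : ∀ m x, pX A m a b x ^ 2 + qX A m a b x ^ 2 + pdR m (h m) x =
      a x * pX A m (pX A m a b) (qX A m a b) x + b x * qX A m (pX A m a b) (qX A m a b) x := by
    intro m x
    have e : pdR m (h m) x = (pdR m a x * qX A m a b x + a x * pdR m (qX A m a b) x)
        - (pdR m b x * pX A m a b x + b x * pdR m (pX A m a b) x) := by
      simp only [h]
      rw [pdR_sub' m (ha.mul (sq m)) (hb.mul (sp m)), pdR_mul' m ha (sq m), pdR_mul' m hb (sp m)]
    rw [e]
    have e1 : pX A m (pX A m a b) (qX A m a b) x = pdR m (qX A m a b) x - A m x * pX A m a b x := rfl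
    have e2 : qX A m (pX A m a b) (qX A m a b) x =
      - pdR m (pX A m a b) x - A m x * qX A m a b x := rfl
    have e3 : pdR m b x = pX A m a b x + A m x * a x := by simp [pX]
    have e4 : pdR m a x = - qX A m a b x - A m x * b x := by simp [qX]
    rw [e1, e2, e3, e4]
    ring
  have pt : ∀ x, (∑ m, (pX A m a b x ^ 2 + qX A m a b x ^ 2 + pdR m (h m) x)) ≤
      ‖Pop A U V (cx a b) x‖ * ‖cx a b x‖ := by
    intro x
    have r1 : (∑ m, (pX A m a b x ^ 2 + qX A m a b x ^ 2 + pdR m (h m) x))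
        + (∑ ℓ, (U ℓ x)^2) * (a x ^ 2 + b x ^ 2) =
        (Pop A U V (cx a b) x * (starRingEnd ℂ) (cx a b x)).re := by
      rw [hP, add_mul, Complex.add_re, Finset.sum_mul Finset.univ (fun m => cx _ _ x), Complex.re_sum]
      congr 1
      · refine Finset.sum_congr rfl (fun m _ => ?_)
        rw [dh]
        simp [cx]; ring
      · rw [mul_assoc, Complex.mul_conj, Complex.normSq_eq_norm_sq, norm_cx, Complex.re_mul_ofReal]
        have w : (Wfun U V x).re = ∑ ℓ, (U ℓ x)^2 := by
          unfold Wfun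
          rw [Complex.add_re, Complex.ofReal_re, Complex.re_ofReal_mul, Complex.I_re]
          ring
        rw [w]
    have r2 := Complex.re_le_norm (Pop A U V (cx a b) x * (starRingEnd ℂ) (cx a b x))
    rw [norm_mul, RCLike.norm_conj] at r2
    have r3 : 0 ≤ (∑ ℓ, (U ℓ x)^2) * (a x ^ 2 + b x ^ 2) :=
      mul_nonneg (Finset.sum_nonneg fun _ _ => sq_nonneg _) (by positivity)
    linarith
  have step : (∑ m, ∫ x, (pX A m a b x ^ 2 + qX A m a b x ^ 2)) =
      ∫ x, ∑ m, (pX A m a b x ^ 2 + qX A m a b x ^ 2 + pdR m (h m) x) := by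
    have L4h : ∀ m, Integrable (fun x => pX A m a b x ^ 2 + qX A m a b x ^ 2 + pdR m (h m) x) :=
      fun m => (L4 m).add (Lh m)
    rw [integral_finsetSum _ (fun m _ => L4h m)]
    refine Finset.sum_congr rfl (fun m _ => ?_)
    rw [integral_add (L4 m) (Lh m), Ih m, add_zero]
  rw [step]
  have mP : MemLp (fun x => ‖Pop A U V (cx a b) x‖) (ENNReal.ofReal 2) :=
    cP.norm.memLp_of_hasCompactSupport (HasCompactSupport.intro hK fun x hx => by simp [PK x hx])
  have mu : MemLp (fun x => ‖cx a b x‖) (ENNReal.ofReal 2) :=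
    cu.norm.memLp_of_hasCompactSupport (HasCompactSupport.intro hK fun x hx => by simp [uK x hx])
  have hol := integral_mul_le_Lp_mul_Lq_of_nonneg (μ := (volume : Measure (Rd d)))
    Real.HolderConjugate.two_two
    (Filter.Eventually.of_forall fun x => norm_nonneg (Pop A U V (cx a b) x))
    (Filter.Eventually.of_forall fun x => norm_nonneg (cx a b x)) mP mu
  rw [← Real.sqrt_eq_rpow, ← Real.sqrt_eq_rpow] at hol
  simp only [Real.rpow_two] at hol
  refine le_trans (integral_mono (integrable_finsetSum _ (fun m _ => (L4 m).add (Lh m)))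
    (integrable_off hK (cP.norm.mul cu.norm) (fun x hx => by simp [uK x hx])) pt) hol

end helpers

/-- weighted bound for the magnetic field:
`‖Ψ^{-1/2} B_{jk} u‖² ≤ C'(∑_m ‖X_m u‖² + ‖u‖²)` and consequently
`‖Ψ^{-1/2} B_{jk} u‖² ≤ C'(‖P_{A,W}u‖ ‖u‖ + ‖u‖²)`. -/
theorem statement_4 (d p : ℕ) (hd : 1 ≤ d)
    (A : Fin d → Rd d → ℝ) (U : Fin p → Rd d → ℝ) (V : Rd d → ℝ)
    (hA : ∀ m, ContDiff ℝ (⊤ : ℕ∞) (A m)) (hU : ∀ ℓ, ContDiff ℝ (⊤ : ℕ∞) (U ℓ)) (hV : ContDiff ℝ (⊤ : ℕ∞) V)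
    (Ψ : Rd d → ℝ) (hΨ : ContDiff ℝ (⊤ : ℕ∞) Ψ) (hΨpos : ∀ x, 0 < Ψ x)
    (j k : Fin d) (hjk : j < k)
    (C : ℝ) (hC : 0 < C)
    (h1 : ∀ x, 1 ≤ C * Ψ x)
    (hB : ∀ x, |magB A j k x| ≤ C * Ψ x)
    (hB' : ∀ (ℓ : Fin d) x, |pdR ℓ (magB A j k) x| ≤ C * Ψ x)
    (hΨd : ∀ ℓ : Fin d, ∃ Cℓ > 0, ∀ x, |pdR ℓ Ψ x| ≤ Cℓ * Ψ x) :
    ∃ C' > 0, ∀ u : Rd d → ℂ, ContDiff ℝ (⊤ : ℕ∞) u → HasCompactSupport u →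
      ((∫ x : Rd d, (Ψ x)⁻¹ * (magB A j k x)^2 * ‖u x‖^2)
          ≤ C' * ((∑ m, ∫ x : Rd d, ‖Xop A m u x‖^2) + ∫ x : Rd d, ‖u x‖^2))
      ∧ ((∫ x : Rd d, (Ψ x)⁻¹ * (magB A j k x)^2 * ‖u x‖^2)
          ≤ C' * (Real.sqrt (∫ x : Rd d, ‖Pop A U V u x‖^2)
              * Real.sqrt (∫ x : Rd d, ‖u x‖^2) + ∫ x : Rd d, ‖u x‖^2)) := by
  choose D hD0 hD using hΨd
  have sB : ContDiff ℝ (⊤ : ℕ∞) (magB A j k) := (sm_pdR j (hA k)).sub (sm_pdR k (hA j))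
  have sI : ContDiff ℝ (⊤ : ℕ∞) (fun x => (Ψ x)⁻¹) := hΨ.inv (fun x => (hΨpos x).ne')
  have sg : ContDiff ℝ (⊤ : ℕ∞) (fun x => (Ψ x)⁻¹ * magB A j k x) := sI.mul sB
  have hDS : 0 ≤ ∑ ℓ, D ℓ := Finset.sum_nonneg fun ℓ _ => (hD0 ℓ).le
  set M := C + C * ∑ ℓ, D ℓ with hMdef
  have hMC : C ≤ M := by nlinarith
  have hBq : ∀ x, |(Ψ x)⁻¹ * magB A j k x| ≤ C := by
    intro x
    rw [abs_mul, abs_of_pos (inv_pos.2 (hΨpos x)), inv_mul_le_iff₀ (hΨpos x), mul_comm]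
    exact hB x
  have hM : ∀ x, |(Ψ x)⁻¹ * magB A j k x| ≤ M := fun x => (hBq x).trans hMC
  have hM' : ∀ ℓ x, |pdR ℓ (fun x => (Ψ x)⁻¹ * magB A j k x) x| ≤ M := by
    intro ℓ x
    have hp := hΨpos x
    have e0 : pdR ℓ (magB A j k) x = pdR ℓ (fun y => Ψ y * ((Ψ y)⁻¹ * magB A j k y)) x := by
      congr 1
      funext y
      rw [mul_inv_cancel_left₀ (hΨpos y).ne']
    rw [pdR_mul' ℓ hΨ sg] at e0
    have e1 : pdR ℓ (fun x => (Ψ x)⁻¹ * magB A j k x) x =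
        (Ψ x)⁻¹ * (pdR ℓ (magB A j k) x - pdR ℓ Ψ x * ((Ψ x)⁻¹ * magB A j k x)) := by
      rw [e0]; field_simp; ring
    rw [e1, abs_mul, abs_of_pos (inv_pos.2 hp), inv_mul_le_iff₀ hp]
    have t1 := abs_sub (pdR ℓ (magB A j k) x) (pdR ℓ Ψ x * ((Ψ x)⁻¹ * magB A j k x))
    rw [abs_mul] at t1
    have t2 := mul_le_mul (hD ℓ x) (hBq x) (abs_nonneg _) (mul_pos (hD0 ℓ) hp).le
    have t3 : D ℓ ≤ ∑ ℓ, D ℓ :=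
      Finset.single_le_sum (fun ℓ _ => (hD0 ℓ).le) (Finset.mem_univ ℓ)
    have t4 := mul_le_mul_of_nonneg_left t3 (mul_pos hp hC).le
    have t5 := hB' ℓ x
    rw [hMdef]
    nlinarith
  refine ⟨2 * M, by linarith, fun u hu hcu => ?_⟩
  have ha : ContDiff ℝ (⊤ : ℕ∞) (fun x => (u x).re) := Complex.reCLM.contDiff.comp hu
  have hb : ContDiff ℝ (⊤ : ℕ∞) (fun x => (u x).im) := Complex.imCLM.contDiff.comp hu
  have hK : IsCompact (tsupport u) := hcu
  have u0 : ∀ x, x ∉ tsupport u → u x = 0 := fun x hx => image_eq_zero_of_notMem_tsupport hx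
  have haK : ∀ x, x ∉ tsupport u → (u x).re = 0 := fun x hx => by simp [u0 x hx]
  have hbK : ∀ x, x ∉ tsupport u → (u x).im = 0 := fun x hx => by simp [u0 x hx]
  have hux : u = cx (fun x => (u x).re) (fun x => (u x).im) := by
    funext x; simp [cx, Complex.re_add_im]
  have F1 := first_bound d A hA j k _ sg M hM hM' _ hK _ _ ha hb haK hbK
  have F2 := second_bound d p A U V hA hU hV _ hK _ _ ha hb haK hbK
  rw [← hux] at F2
  have n1 : ∀ x, ‖u x‖^2 = (u x).re ^ 2 + (u x).im ^ 2 := by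
    intro x
    conv_lhs => rw [hux]
    exact norm_cx _ _ x
  have n2 : ∀ m x, ‖Xop A m u x‖^2 =
      pX A m (fun x => (u x).re) (fun x => (u x).im) x ^ 2
        + qX A m (fun x => (u x).re) (fun x => (u x).im) x ^ 2 := by
    intro m x
    conv_lhs => rw [hux, Xop_cx ha hb]
    exact norm_cx _ _ x
  have n3 : ∀ x, (Ψ x)⁻¹ * (magB A j k x)^2 * ‖u x‖^2 =
      (Ψ x)⁻¹ * magB A j k x * magB A j k x * ((u x).re ^ 2 + (u x).im ^ 2) := by
    intro x; rw [n1]; ring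
  simp only [← n1, ← n2] at F1 F2
  have n4 : (∫ x : Rd d, (Ψ x)⁻¹ * (magB A j k x)^2 * ‖u x‖^2) =
      ∫ x, (Ψ x)⁻¹ * magB A j k x * magB A j k x * ‖u x‖^2 := by
    congr 1; funext x; ring
  rw [n4]
  refine ⟨F1, F1.trans ?_⟩
  exact mul_le_mul_of_nonneg_left (by linarith) (by linarith)

end
end

section
/- Let Ψ be a C^∞ positive function on ℝ^d with 1 ≤ C Ψ(x), |V(x)| ≤ C Ψ(x) and |∂_{x_j} V(x)| ≤ C Ψ(x) for all x and some C > 0, together with |∂^α Ψ(x)| ≤ C_α Ψ(x) for |α| ≤ 1. Then there is a constant C' > 0 such that for all complex-valued u ∈ C_0^∞(ℝ^d), ‖ Ψ^{−1/2} V u ‖² ≤ C' ( ‖P_{A,W} u‖ ‖u‖ + ‖u‖² ). -/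
open MeasureTheory Real Filter

noncomputable section

lemma xop_contDiff {d : ℕ} {A : Fin d → Rd d → ℝ} (hA : ∀ m, ContDiff ℝ (⊤ : ℕ∞) (A m))
    (j : Fin d) {u : Rd d → ℂ} (hu : ContDiff ℝ (⊤ : ℕ∞) u) :
    ContDiff ℝ (⊤ : ℕ∞) (Xop A j u) := by
  unfold Xop pdC
  have h1 : ContDiff ℝ (⊤ : ℕ∞) (fun x => fderiv ℝ u x (EuclideanSpace.single j (1:ℝ))) :=
    (hu.fderiv_right (m := (⊤ : ℕ∞)) (by simp)).clm_apply contDiff_const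
  have h2 : ContDiff ℝ (⊤ : ℕ∞) (fun x => (A j x : ℂ)) :=
    Complex.ofRealCLM.contDiff.comp (hA j)
  exact (contDiff_const.mul h1).sub (h2.mul hu)

lemma pop_continuous {d p : ℕ} {A : Fin d → Rd d → ℝ} {U : Fin p → Rd d → ℝ} {V : Rd d → ℝ}
    (hA : ∀ m, ContDiff ℝ (⊤ : ℕ∞) (A m)) (hU : ∀ ℓ, ContDiff ℝ (⊤ : ℕ∞) (U ℓ))
    (hV : ContDiff ℝ (⊤ : ℕ∞) V) {u : Rd d → ℂ} (hu : ContDiff ℝ (⊤ : ℕ∞) u) :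
    Continuous (Pop A U V u) := by
  unfold Pop Wfun
  have h1 : ∀ j, Continuous (Xop A j (Xop A j u)) := fun j =>
    (xop_contDiff hA j (xop_contDiff hA j hu)).continuous
  have h2 : ∀ l, Continuous (U l) := fun l => (hU l).continuous
  have h3 := hV.continuous
  have h4 := hu.continuous
  fun_prop

lemma xop_support {d : ℕ} {A : Fin d → Rd d → ℝ} (j : Fin d) {u : Rd d → ℂ}
    (hc : HasCompactSupport u) : HasCompactSupport (Xop A j u) := by
  have h1 : HasCompactSupport (fun x => fderiv ℝ u x (EuclideanSpace.single j (1:ℝ))) :=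
    hc.fderiv_apply (𝕜 := ℝ) _
  have h2 : HasCompactSupport (fun x => -Complex.I * pdC j u x) :=
    HasCompactSupport.mul_left (f := fun _ => -Complex.I) h1
  have h3 : HasCompactSupport (fun x => (A j x : ℂ) * u x) :=
    HasCompactSupport.mul_left (f := fun x => (A j x : ℂ)) hc
  exact h2.sub h3

lemma pop_support {d p : ℕ} {A : Fin d → Rd d → ℝ} {U : Fin p → Rd d → ℝ} {V : Rd d → ℝ}
    {u : Rd d → ℂ} (hc : HasCompactSupport u) : HasCompactSupport (Pop A U V u) := by
  have h3 : HasCompactSupport (fun x => Wfun U V x * u x) :=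
    HasCompactSupport.mul_left (f := fun x => Wfun U V x) hc
  refine HasCompactSupport.add ?_ h3
  have : ∀ s : Finset (Fin d), HasCompactSupport (fun x => ∑ j ∈ s, Xop A j (Xop A j u) x) := by
    classical
    intro s
    induction s using Finset.induction_on with
    | empty =>
      simp only [Finset.sum_empty]
      exact (HasCompactSupport.zero : HasCompactSupport (0 : Rd d → ℂ))
    | insert a s ha ih =>
      simp only [Finset.sum_insert ha]
      exact (xop_support a (xop_support a hc)).add ih
  exact this _

lemma integral_pdC_zero {d : ℕ} (j : Fin d) {h : Rd d → ℂ} (hh : ContDiff ℝ (⊤ : ℕ∞) h)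
    (hc : HasCompactSupport h) : Integrable (pdC j h) ∧ ∫ x, pdC j h x = 0 := by
  have hcont : Continuous (pdC j h) :=
    ((hh.fderiv_right (m := (⊤ : ℕ∞)) (by simp)).clm_apply contDiff_const).continuous
  have hi : Integrable (pdC j h) :=
    hcont.integrable_of_hasCompactSupport (hc.fderiv_apply (𝕜 := ℝ) _)
  refine ⟨hi, ?_⟩
  have := integral_mul_fderiv_eq_neg_fderiv_mul_of_integrable (μ := (volume : Measure (Rd d)))
    (f := fun _ => (1:ℂ)) (g := h) (v := EuclideanSpace.single j (1:ℝ))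
    (by simp) (by simp only [one_mul]; exact hi)
    (by simpa using hh.continuous.integrable_of_hasCompactSupport hc)
    (fun x _ => by fun_prop) (fun x _ => hh.differentiable (by simp) x)
  simpa [pdC] using this

lemma flux {d : ℕ} {A : Fin d → Rd d → ℝ} (hA : ∀ m, ContDiff ℝ (⊤ : ℕ∞) (A m))
    {u : Rd d → ℂ} (hu : ContDiff ℝ (⊤ : ℕ∞) u) (hc : HasCompactSupport u)
    {φ : Rd d → ℝ} (hφ : ContDiff ℝ (⊤ : ℕ∞) φ) (j : Fin d) :
    ∃ H : Rd d → ℂ, Integrable H ∧ (∫ x, H x = 0) ∧ ∀ x,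
      Xop A j (Xop A j u) x * (φ x * (starRingEnd ℂ) (u x)) = H x
        + φ x * (‖Xop A j u x‖^2 : ℝ)
        + Complex.I * pdR j φ x * Xop A j u x * (starRingEnd ℂ) (u x) := by
  have hX := xop_contDiff hA j hu
  have hsu : ContDiff ℝ (⊤ : ℕ∞) (fun x => (starRingEnd ℂ) (u x)) :=
    Complex.conjCLE.contDiff.comp hu
  have hφc : ContDiff ℝ (⊤ : ℕ∞) (fun x => (φ x : ℂ)) := Complex.ofRealCLM.contDiff.comp hφ
  have hh : ContDiff ℝ (⊤ : ℕ∞)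
      (fun x => Xop A j u x * ((φ x : ℂ) * (starRingEnd ℂ) (u x))) := hX.mul (hφc.mul hsu)
  have hcs : HasCompactSupport
      (fun x => Xop A j u x * ((φ x : ℂ) * (starRingEnd ℂ) (u x))) :=
    HasCompactSupport.mul_right (xop_support j hc)
  obtain ⟨hi, h0⟩ := integral_pdC_zero j hh hcs
  refine ⟨fun x => -Complex.I * pdC j _ x, hi.const_mul _, ?_, ?_⟩
  · rw [integral_const_mul, h0, mul_zero]
  intro x
  have e1 := (hX.differentiable (by simp) x).hasFDerivAt
  have e2 : HasFDerivAt (fun x => (φ x : ℂ)) (Complex.ofRealCLM ∘L fderiv ℝ φ x) x :=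
    Complex.ofRealCLM.hasFDerivAt.comp x (hφ.differentiable (by simp) x).hasFDerivAt
  have e3 : HasFDerivAt (fun x => (starRingEnd ℂ) (u x))
      ((Complex.conjCLE : ℂ →L[ℝ] ℂ) ∘L fderiv ℝ u x) x :=
    (Complex.conjCLE : ℂ →L[ℝ] ℂ).hasFDerivAt.comp x (hu.differentiable (by simp) x).hasFDerivAt
  have e4 : pdC j (fun x => Xop A j u x * ((φ x : ℂ) * (starRingEnd ℂ) (u x))) x
      = Xop A j u x * (φ x * (starRingEnd ℂ) (pdC j u x) + pdR j φ x * (starRingEnd ℂ) (u x))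
        + pdC j (Xop A j u) x * (φ x * (starRingEnd ℂ) (u x)) := by
    have := (e1.mul (e2.mul e3)).fderiv
    unfold pdC at *
    erw [this]
    simp [pdR]
    ring
  beta_reduce
  rw [e4]
  have e5 : ((‖Xop A j u x‖^2 : ℝ) : ℂ) = Xop A j u x * (starRingEnd ℂ) (Xop A j u x) := by
    rw [Complex.mul_conj, Complex.normSq_eq_norm_sq]
  have e6 : Xop A j (Xop A j u) x
      = -Complex.I * pdC j (Xop A j u) x - (A j x : ℂ) * Xop A j u x := rfl
  have e7 : (starRingEnd ℂ) (Xop A j u x)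
      = Complex.I * (starRingEnd ℂ) (pdC j u x) - (A j x : ℂ) * (starRingEnd ℂ) (u x) := by
    simp [Xop]
  rw [e5, e6, e7]
  ring

lemma fluxP {d p : ℕ} {A : Fin d → Rd d → ℝ} {U : Fin p → Rd d → ℝ} {V : Rd d → ℝ}
    (hA : ∀ m, ContDiff ℝ (⊤ : ℕ∞) (A m))
    {u : Rd d → ℂ} (hu : ContDiff ℝ (⊤ : ℕ∞) u) (hc : HasCompactSupport u)
    {φ : Rd d → ℝ} (hφ : ContDiff ℝ (⊤ : ℕ∞) φ) :
    ∃ H : Rd d → ℂ, Integrable H ∧ (∫ x, H x = 0) ∧ ∀ x,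
      Pop A U V u x * (φ x * (starRingEnd ℂ) (u x)) = H x
        + ((φ x * ∑ j, ‖Xop A j u x‖^2 : ℝ) : ℂ)
        + (∑ j, Complex.I * pdR j φ x * Xop A j u x * (starRingEnd ℂ) (u x))
        + Wfun U V x * ((φ x * ‖u x‖^2 : ℝ) : ℂ) := by
  choose H hi h0 hH using fun j => flux hA hu hc hφ j
  refine ⟨fun x => ∑ j, H j x, integrable_finsetSum _ fun j _ => hi j, ?_, ?_⟩
  · rw [integral_finsetSum _ fun j _ => hi j]
    simp [h0]
  intro x
  have e5 : ((‖u x‖^2 : ℝ) : ℂ) = u x * (starRingEnd ℂ) (u x) := by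
    rw [Complex.mul_conj, Complex.normSq_eq_norm_sq]
  have e : ((φ x * ∑ j, ‖Xop A j u x‖^2 : ℝ) : ℂ) = ∑ j, φ x * ((‖Xop A j u x‖^2 : ℝ) : ℂ) := by
    rw [Complex.ofReal_mul, Complex.ofReal_sum, Finset.mul_sum]
  rw [Complex.ofReal_mul (φ x) (‖u x‖^2), e5, e, ← Finset.sum_add_distrib,
    ← Finset.sum_add_distrib]
  simp only [← hH]
  rw [← Finset.sum_mul]
  unfold Pop
  ring

lemma cs_int {d : ℕ} {f g : Rd d → ℂ} (hf : Continuous f) (hg : Continuous g)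
    (hfc : HasCompactSupport f) (hgc : HasCompactSupport g) :
    ∫ x, ‖f x‖ * ‖g x‖ ≤ Real.sqrt (∫ x, ‖f x‖^2) * Real.sqrt (∫ x, ‖g x‖^2) := by
  have := integral_mul_le_Lp_mul_Lq_of_nonneg (μ := (volume : Measure (Rd d)))
    Real.HolderConjugate.two_two
    (f := fun x => ‖f x‖) (g := fun x => ‖g x‖)
    (Eventually.of_forall fun x => norm_nonneg _) (Eventually.of_forall fun x => norm_nonneg _)
    (hf.norm.memLp_of_hasCompactSupport hfc.norm) (hg.norm.memLp_of_hasCompactSupport hgc.norm)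
  simpa [Real.sqrt_eq_rpow] using this

set_option maxHeartbeats 2000000 in
/-- weighted bound for the imaginary part of the potential:
`‖Ψ^{-1/2} V u‖² ≤ C'(‖P_{A,W}u‖ ‖u‖ + ‖u‖²)`. -/
theorem statement_5 (d p : ℕ) (hd : 1 ≤ d)
    (A : Fin d → Rd d → ℝ) (U : Fin p → Rd d → ℝ) (V : Rd d → ℝ)
    (hA : ∀ m, ContDiff ℝ (⊤ : ℕ∞) (A m)) (hU : ∀ ℓ, ContDiff ℝ (⊤ : ℕ∞) (U ℓ)) (hV : ContDiff ℝ (⊤ : ℕ∞) V)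
    (Ψ : Rd d → ℝ) (hΨ : ContDiff ℝ (⊤ : ℕ∞) Ψ) (hΨpos : ∀ x, 0 < Ψ x)
    (C : ℝ) (hC : 0 < C)
    (h1 : ∀ x, 1 ≤ C * Ψ x)
    (hVb : ∀ x, |V x| ≤ C * Ψ x)
    (hVb' : ∀ (j : Fin d) x, |pdR j V x| ≤ C * Ψ x)
    (hΨd : ∀ j : Fin d, ∃ Cj > 0, ∀ x, |pdR j Ψ x| ≤ Cj * Ψ x) :
    ∃ C' > 0, ∀ u : Rd d → ℂ, ContDiff ℝ (⊤ : ℕ∞) u → HasCompactSupport u →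
      (∫ x : Rd d, (Ψ x)⁻¹ * (V x)^2 * ‖u x‖^2)
        ≤ C' * (Real.sqrt (∫ x : Rd d, ‖Pop A U V u x‖^2)
            * Real.sqrt (∫ x : Rd d, ‖u x‖^2) + ∫ x : Rd d, ‖u x‖^2) := by
  choose Cj hCj hΨd using hΨd
  have hφ : ContDiff ℝ (⊤ : ℕ∞) (fun x => V x * (Ψ x)⁻¹) :=
    hV.mul (hΨ.inv fun x => (hΨpos x).ne')
  obtain ⟨K, hK, hKb⟩ : ∃ K > 0, ∀ j x, |pdR j (fun x => V x * (Ψ x)⁻¹) x| ≤ K := by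
    refine ⟨C + C * ∑ j, Cj j, ?_, ?_⟩
    · have : 0 ≤ ∑ j, Cj j := Finset.sum_nonneg fun j _ => (hCj j).le
      positivity
    intro j x
    have hp := hΨpos x
    have e1 := (hV.differentiable (by simp) x).hasFDerivAt
    have e2 := (hΨ.differentiable (by simp) x).hasFDerivAt
    have e3 : HasFDerivAt (fun x => (Ψ x)⁻¹) _ x := (hasFDerivAt_inv hp.ne').comp x e2
    have e4 : pdR j (fun x => V x * (Ψ x)⁻¹) x
        = pdR j V x * (Ψ x)⁻¹ - (V x * (Ψ x)⁻¹) * (pdR j Ψ x * (Ψ x)⁻¹) := by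
      have := (e1.mul e3).fderiv
      unfold pdR
      erw [this]
      simp
      field_simp
      ring
    have b : ∀ y c : ℝ, |y| ≤ c * Ψ x → |y * (Ψ x)⁻¹| ≤ c := by
      intro y c hy
      rw [abs_mul, abs_inv, abs_of_pos hp, ← div_eq_mul_inv, div_le_iff₀ hp]
      exact hy
    rw [e4]
    have b1 := b _ _ (hVb' j x)
    have b2 := b _ _ (hVb x)
    have b3 := b _ _ (hΨd j x)
    have b4 : Cj j ≤ ∑ j, Cj j :=
      Finset.single_le_sum (f := Cj) (fun j _ => (hCj j).le) (Finset.mem_univ j)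
    refine (abs_sub _ _).trans ?_
    rw [abs_mul (V x * (Ψ x)⁻¹)]
    have := mul_le_mul b2 (b3.trans b4) (abs_nonneg _) hC.le
    linarith
  have hφb : ∀ x, |V x * (Ψ x)⁻¹| ≤ C := by
    intro x
    have hp := hΨpos x
    rw [abs_mul, abs_inv, abs_of_pos hp, ← div_eq_mul_inv, div_le_iff₀ hp]
    exact hVb x
  refine ⟨(C + K) + K * d, by positivity, ?_⟩
  intro u hu hc
  obtain ⟨H1, i1, z1, f1⟩ := fluxP (U := U) (V := V) hA hu hc (φ := fun _ => 1) contDiff_const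
  obtain ⟨H2, i2, z2, f2⟩ := fluxP (U := U) (V := V) hA hu hc hφ
  have hPc := pop_continuous (U := U) (V := V) hA hU hV hu
  have hPs := pop_support (A := A) (U := U) (V := V) hc
  have key : ∀ x, (Ψ x)⁻¹ * (V x)^2 * ‖u x‖^2 ≤ -(H2 x).im - K * (H1 x).re
      + (C + K) * (‖Pop A U V u x‖ * ‖u x‖) + K * d * ‖u x‖^2 := by
    intro x
    set S := ∑ j, ‖Xop A j u x‖^2 with hS
    have g1 : S ≤ -(H1 x).re + ‖Pop A U V u x‖ * ‖u x‖ := by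
      have h := congrArg Complex.re (f1 x)
      have hz : ∀ j : Fin d, pdR j (fun _ : Rd d => (1:ℝ)) x = 0 := by
        intro j; simp [pdR]
      have hle := Complex.re_le_norm (Pop A U V u x * (((1:ℝ):ℂ) * (starRingEnd ℂ) (u x)))
      rw [h] at hle
      simp only [hz] at hle
      simp [Wfun, -Complex.mul_re, -Complex.ofReal_sum, -Complex.ofReal_pow] at hle
      have hU0 : 0 ≤ (∑ l, (U l x)^2) * ‖u x‖^2 := by positivity
      rw [← hS] at hle
      simp [-Complex.ofReal_sum, ← Complex.ofReal_pow] at hle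
      linarith
    have g2 : (Ψ x)⁻¹ * (V x)^2 * ‖u x‖^2 ≤ -(H2 x).im + C * (‖Pop A U V u x‖ * ‖u x‖)
        + ∑ j : Fin d, K * (‖Xop A j u x‖ * ‖u x‖) := by
      have h := congrArg Complex.im (f2 x)
      have hle := Complex.abs_im_le_norm
        (Pop A U V u x * (((V x * (Ψ x)⁻¹ : ℝ):ℂ) * (starRingEnd ℂ) (u x)))
      have hn : ‖Pop A U V u x * (((V x * (Ψ x)⁻¹ : ℝ):ℂ) * (starRingEnd ℂ) (u x))‖
          ≤ C * (‖Pop A U V u x‖ * ‖u x‖) := by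
        rw [norm_mul, norm_mul, Complex.norm_real, Real.norm_eq_abs, RCLike.norm_conj]
        have := mul_le_mul_of_nonneg_right (hφb x)
          (show 0 ≤ ‖Pop A U V u x‖ * ‖u x‖ by positivity)
        linarith
      have hs : |(∑ j, Complex.I * pdR j (fun x => V x * (Ψ x)⁻¹) x * Xop A j u x
          * (starRingEnd ℂ) (u x)).im| ≤ ∑ j : Fin d, K * (‖Xop A j u x‖ * ‖u x‖) := by
        refine (Complex.abs_im_le_norm _).trans ((norm_sum_le _ _).trans ?_)
        refine Finset.sum_le_sum fun j _ => ?_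
        rw [norm_mul, norm_mul, norm_mul, Complex.norm_real, Real.norm_eq_abs, RCLike.norm_conj,
          Complex.norm_I, one_mul, mul_assoc]
        exact mul_le_mul_of_nonneg_right (hKb j x) (by positivity)
      have hw : (Wfun U V x * ((V x * (Ψ x)⁻¹ * ‖u x‖^2 : ℝ) : ℂ)).im
          = (Ψ x)⁻¹ * (V x)^2 * ‖u x‖^2 := by
        rw [Complex.im_mul_ofReal]
        simp only [Wfun, Complex.add_im, Complex.ofReal_im, Complex.im_ofReal_mul, Complex.I_im]
        ring
      rw [Complex.add_im, Complex.add_im, Complex.add_im, Complex.ofReal_im, hw] at h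
      have a1 := abs_le.1 (hle.trans hn)
      have a2 := abs_le.1 hs
      linarith [a1.2, a2.1]
    have g3 : ∑ j : Fin d, K * (‖Xop A j u x‖ * ‖u x‖) ≤ K * (S + d * ‖u x‖^2) := by
      rw [← Finset.mul_sum]
      refine mul_le_mul_of_nonneg_left ?_ hK.le
      calc ∑ j : Fin d, ‖Xop A j u x‖ * ‖u x‖
          ≤ ∑ j : Fin d, (‖Xop A j u x‖^2 + ‖u x‖^2) := Finset.sum_le_sum fun j _ => by
            nlinarith [sq_nonneg (‖Xop A j u x‖ - ‖u x‖), sq_nonneg ‖Xop A j u x‖,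
              sq_nonneg ‖u x‖]
        _ = S + d * ‖u x‖^2 := by rw [Finset.sum_add_distrib]; simp [hS]
    have g4 := mul_le_mul_of_nonneg_left g1 hK.le
    linarith
  have huc := hu.continuous
  have su : HasCompactSupport (fun x => ‖u x‖^2) :=
    hc.norm.comp_left (g := fun t : ℝ => t^2) (by simp)
  have cu : Continuous (fun x => ‖u x‖^2) := huc.norm.pow 2
  have iu : Integrable (fun x => ‖u x‖^2) := cu.integrable_of_hasCompactSupport su
  have iP : Integrable (fun x => ‖Pop A U V u x‖ * ‖u x‖) :=
    (hPc.norm.mul huc.norm).integrable_of_hasCompactSupport hPs.norm.mul_right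
  have iL : Integrable (fun x => (Ψ x)⁻¹ * (V x)^2 * ‖u x‖^2) := by
    refine Continuous.integrable_of_hasCompactSupport ?_ ?_
    · exact ((hΨ.continuous.inv₀ fun x => (hΨpos x).ne').mul (hV.continuous.pow 2)).mul
        (huc.norm.pow 2)
    · exact HasCompactSupport.mul_left su
  have i2' : Integrable (fun x => -(H2 x).im) := i2.im.neg
  have i1' : Integrable (fun x => K * (H1 x).re) := i1.re.const_mul K
  have z2' : ∫ x, (H2 x).im = 0 := by
    have := integral_im i2
    simp only [RCLike.im_eq_complex_im] at this
    rw [this, z2]; rfl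
  have z1' : ∫ x, (H1 x).re = 0 := by
    have := integral_re i1
    simp only [RCLike.re_eq_complex_re] at this
    rw [this, z1]; rfl
  have iQ : Integrable (fun x => (C + K) * (‖Pop A U V u x‖ * ‖u x‖)) := iP.const_mul (C + K)
  have iv : Integrable (fun x => K * d * ‖u x‖^2) := iu.const_mul (K * d)
  have j1 : Integrable (fun x => -(H2 x).im - K * (H1 x).re) := i2'.sub i1'
  have j2 : Integrable (fun x => -(H2 x).im - K * (H1 x).re
      + (C + K) * (‖Pop A U V u x‖ * ‖u x‖)) := j1.add iQ
  have j3 : Integrable (fun x => -(H2 x).im - K * (H1 x).re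
      + (C + K) * (‖Pop A U V u x‖ * ‖u x‖) + K * d * ‖u x‖^2) := j2.add iv
  have fin := integral_mono iL j3 key
  have e : ∫ x, (-(H2 x).im - K * (H1 x).re
      + (C + K) * (‖Pop A U V u x‖ * ‖u x‖) + K * d * ‖u x‖^2)
      = (C + K) * (∫ x, ‖Pop A U V u x‖ * ‖u x‖) + K * d * ∫ x, ‖u x‖^2 := by
    rw [integral_add j2 iv, integral_add j1 iQ, integral_sub i2' i1',
      integral_neg, integral_const_mul, integral_const_mul, integral_const_mul, z1', z2']
    simp
  refine fin.trans (e.le.trans ?_)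
  have cs := cs_int hPc huc hPs hc
  have n1 : 0 ≤ Real.sqrt (∫ x : Rd d, ‖Pop A U V u x‖^2) * Real.sqrt (∫ x : Rd d, ‖u x‖^2) := by
    positivity
  have n2 : 0 ≤ ∫ x : Rd d, ‖u x‖^2 := integral_nonneg fun x => by positivity
  have n3 := mul_le_mul_of_nonneg_left cs (show 0 ≤ C + K by positivity)
  have n4 : 0 ≤ K * d := by positivity
  nlinarith [mul_nonneg n4 n1, mul_nonneg (show 0 ≤ C + K by positivity) n2]

end
end
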